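/- arXiv:2505.22697 — 3 statements merged into one kernel-verified Lean document; each statement's English description precedes it below -/
import Mathlib

section
/- Let Q and K be real S×(H·d_k) matrices with column blocks Q_i, K_i (each S×d_k), let π be a permutation of {1,…,H}, let P^{(i)} be d_k×d_k permutation matrices, and set P_attn = Σ_{i=1}^{H} E^{i,π(i)} ⊗ P^{(i)}, Q' = Q P_attn, K' = K P_attn, with column blocks Q'_i, K'_i. Then for every head i: Q'_i (K'_i)ᵀ = Q_{π⁻¹(i)} (K_{π⁻¹(i)})ᵀ, i.e., the per-head attention-score Gram matrices are unchanged up to the inter-head relabeling π, with the intra-head permutations cancelling by orthogonality. -/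
open Matrix Kronecker

/-- The permutation matrix associated with a permutation `σ`:
`(P_σ)_{u,v} = 1` if `u = σ v` and `0` otherwise. -/
def permMatrix {ι : Type*} [DecidableEq ι] (σ : Equiv.Perm ι) : Matrix ι ι ℝ :=
  Matrix.of fun u v => if u = σ v then (1 : ℝ) else 0

/-- The block permutation `P_attn = Σ_{i} E^{i,π(i)} ⊗ P^{(i)}`. -/
def Pattn {H dk : ℕ} (π : Equiv.Perm (Fin H)) (ρ : Fin H → Equiv.Perm (Fin dk)) :
    Matrix (Fin H × Fin dk) (Fin H × Fin dk) ℝ :=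
  ∑ i : Fin H, (Matrix.single i (π i) (1 : ℝ)) ⊗ₖ permMatrix (ρ i)

/-- The `i`-th column block (an `S × d_k` matrix) of an `S × (H·d_k)` matrix whose
columns are indexed by pairs `(head index, within-head index)`. -/
def blockCol {S H dk : ℕ} (Q : Matrix (Fin S) (Fin H × Fin dk) ℝ) (i : Fin H) :
    Matrix (Fin S) (Fin dk) ℝ :=
  Matrix.of fun s a => Q s (i, a)

theorem blockCol_mul_Pattn {S H dk : ℕ} (Q : Matrix (Fin S) (Fin H × Fin dk) ℝ)
    (π : Equiv.Perm (Fin H)) (ρ : Fin H → Equiv.Perm (Fin dk)) (i : Fin H)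
    (s : Fin S) (a : Fin dk) :
    blockCol (Q * Pattn π ρ) i s a = blockCol Q (π.symm i) s (ρ (π.symm i) a) := by
  have key : ∀ (j : Fin H) (b : Fin dk), Pattn π ρ (j, b) (i, a) =
      if (j, b) = (π.symm i, ρ (π.symm i) a) then (1 : ℝ) else 0 := by
    intro j b
    simp only [Pattn, Matrix.sum_apply, Matrix.kroneckerMap_apply, permMatrix, Matrix.of_apply,
      Matrix.single_apply]
    rw [Finset.sum_eq_single j]
    · by_cases h : π j = i
      · subst h
        simp
      · have h2 : j ≠ π.symm i := fun h' => h (by rw [h']; simp)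
        simp [h, h2]
    · intro c _ hc
      simp [hc]
    · simp
  simp only [blockCol, Matrix.of_apply, Matrix.mul_apply]
  rw [Finset.sum_eq_single (π.symm i, ρ (π.symm i) a)]
  · rw [key]; simp
  · rintro ⟨j, b⟩ _ h
    rw [key, if_neg h, mul_zero]
  · simp

/-- With `Q' = Q P_attn` and `K' = K P_attn`, for every head `i`:
`Q'_i (K'_i)ᵀ = Q_{π⁻¹(i)} (K_{π⁻¹(i)})ᵀ` — the per-head attention-score Gram matrices
are unchanged up to the inter-head relabeling `π`, the intra-head permutations
cancelling by orthogonality. -/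
theorem gram_blocks_of_permuted {S H dk : ℕ}
    (Q K : Matrix (Fin S) (Fin H × Fin dk) ℝ)
    (π : Equiv.Perm (Fin H)) (ρ : Fin H → Equiv.Perm (Fin dk)) :
    ∀ i : Fin H,
      blockCol (Q * Pattn π ρ) i * (blockCol (K * Pattn π ρ) i)ᵀ =
        blockCol Q (π.symm i) * (blockCol K (π.symm i))ᵀ := by
  intro i
  ext s t
  simp only [Matrix.mul_apply, Matrix.transpose_apply, blockCol_mul_Pattn]
  exact Equiv.sum_comp (ρ (π.symm i))
    (fun b => blockCol Q (π.symm i) s b * blockCol K (π.symm i) t b)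
end

section
/- (Equivariance of multi-head attention to structured permutations.) Let X be a real S×d_m matrix, let W_q, W_k, W_v be real d_m×d_m matrices, let H ≥ 1 divide d_m and set d_k = d_m/H, identifying column indices {1,…,d_m} with pairs (i,a), i ∈ {1,…,H}, a ∈ {1,…,d_k}. Define Q = X W_q, K = X W_k, V = X W_v with column blocks Q_i, K_i, V_i, per-head attention A_i = softmax(Q_i K_iᵀ / √d_k) applied row-wise, per-head outputs O_i = A_i V_i, and O the S×d_m matrix whose i-th column block is O_i. Let π be a permutation of {1,…,H}, P^{(i)} d_k×d_k permutation matrices, and P_attn = Σ_{i=1}^{H} E^{i,π(i)} ⊗ P^{(i)}. Define the permuted projections W_q' = W_q P_attn, W_k' = W_k P_attn, W_v' = W_v P_attn and build Q', K', V', A'_i = softmax(Q'_i (K'_i)ᵀ / √d_k), O'_i = A'_i V'_i, and O' analogously. Then O' = O P_attn. -/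
open Matrix Kronecker

/-- Row-wise softmax of a real `S × S` matrix:
`softmax(M)_{ij} = exp(M_{ij}) / Σ_k exp(M_{ik})`. -/
noncomputable def softmax {S : ℕ} (M : Matrix (Fin S) (Fin S) ℝ) :
    Matrix (Fin S) (Fin S) ℝ :=
  Matrix.of fun i j => Real.exp (M i j) / ∑ k, Real.exp (M i k)

/-- Multi-head attention output: with `Q = X W_q`, `K = X W_k`, `V = X W_v` split into
`H` column blocks of width `d_k`, per-head attention `A_i = softmax(Q_i K_iᵀ / √d_k)`
(row-wise) and per-head outputs `O_i = A_i V_i`, this is the `S × (H·d_k)` matrix whose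
`i`-th column block is `O_i`. -/
noncomputable def MHA {S H dk : ℕ} (X : Matrix (Fin S) (Fin H × Fin dk) ℝ)
    (Wq Wk Wv : Matrix (Fin H × Fin dk) (Fin H × Fin dk) ℝ) :
    Matrix (Fin S) (Fin H × Fin dk) ℝ :=
  Matrix.of fun s p =>
    (softmax ((1 / Real.sqrt (dk : ℝ)) •
        (blockCol (X * Wq) p.1 * (blockCol (X * Wk) p.1)ᵀ)) *
      blockCol (X * Wv) p.1) s p.2

theorem Pattn_apply_aux {H dk : ℕ} (π : Equiv.Perm (Fin H)) (ρ : Fin H → Equiv.Perm (Fin dk))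
    (p q : Fin H × Fin dk) :
    Pattn π ρ p q = if p = (π.symm q.1, ρ (π.symm q.1) q.2) then (1 : ℝ) else 0 := by
  obtain ⟨i, a⟩ := p
  obtain ⟨j, b⟩ := q
  unfold Pattn
  rw [Matrix.sum_apply, Finset.sum_eq_single i]
  · by_cases h : i = π.symm j
    · subst h
      simp [permMatrix, Matrix.kroneckerMap_apply]
    · have h2 : π i ≠ j := fun h' => h (by simp [← h'])
      simp [Matrix.kroneckerMap_apply, Matrix.single_apply, h, h2]
  · intro k _ hk
    simp [Matrix.kroneckerMap_apply, Matrix.single_apply, hk]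
  · simp

theorem mul_Pattn_aux {S H dk : ℕ} (M : Matrix (Fin S) (Fin H × Fin dk) ℝ)
    (π : Equiv.Perm (Fin H)) (ρ : Fin H → Equiv.Perm (Fin dk))
    (s : Fin S) (q : Fin H × Fin dk) :
    (M * Pattn π ρ) s q = M s (π.symm q.1, ρ (π.symm q.1) q.2) := by
  simp only [Matrix.mul_apply, Pattn_apply_aux, mul_ite, mul_one, mul_zero,
    Finset.sum_ite_eq', Finset.sum_ite_eq, Finset.mem_univ, if_true]

theorem blockCol_aux {S H dk : ℕ} (Q K : Matrix (Fin S) (Fin H × Fin dk) ℝ)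
    (π : Equiv.Perm (Fin H)) (ρ : Fin H → Equiv.Perm (Fin dk)) (j : Fin H) :
    blockCol (Q * Pattn π ρ) j * (blockCol (K * Pattn π ρ) j)ᵀ =
      blockCol Q (π.symm j) * (blockCol K (π.symm j))ᵀ := by
  ext s t
  simp only [Matrix.mul_apply (M := blockCol _ _), Matrix.transpose_apply, blockCol, Matrix.of_apply,
    mul_Pattn_aux]
  simp only [Matrix.mul_apply, Matrix.transpose_apply, Matrix.of_apply, mul_Pattn_aux]
  exact Equiv.sum_comp (ρ (π.symm j)) (fun a => Q s (π.symm j, a) * K t (π.symm j, a))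

/-- Equivariance of multi-head attention to structured permutations.
Replacing the projections `W_q, W_k, W_v` by `W_q P_attn, W_k P_attn, W_v P_attn`, where
`P_attn = Σ_i E^{i,π(i)} ⊗ P^{(i)}` combines a head permutation `π` with intra-head
permutations `P^{(i)}`, permutes the multi-head attention output: `O' = O P_attn`. -/
theorem mha_equivariant {S H dk : ℕ} (hH : 1 ≤ H)
    (X : Matrix (Fin S) (Fin H × Fin dk) ℝ)
    (Wq Wk Wv : Matrix (Fin H × Fin dk) (Fin H × Fin dk) ℝ)
    (π : Equiv.Perm (Fin H)) (ρ : Fin H → Equiv.Perm (Fin dk)) :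
    MHA X (Wq * Pattn π ρ) (Wk * Pattn π ρ) (Wv * Pattn π ρ) =
      MHA X Wq Wk Wv * Pattn π ρ := by
  ext s q
  rw [mul_Pattn_aux]
  simp only [MHA, Matrix.of_apply, ← Matrix.mul_assoc, blockCol_aux]
  rw [Matrix.mul_apply, Matrix.mul_apply]
  simp only [blockCol, Matrix.of_apply, mul_Pattn_aux]
end

section
/- Consider a transformer residual block on ℝ^d with weights W_0, W_1, W_2 (real d×d matrices), an arbitrary function f : ℝ^d → ℝ^d (the multi-head attention map), and entrywise ReLU(v)_j = max(v_j, 0). The original block computes z_attn = W_0 f(x), z_i = z_attn + x, z_f = W_2 ReLU(W_1 z_i), z_out = z_f + z_i. Let P_in, P_attn, P_{W_0}, P_{W_1}, P_{W_2} be d×d permutation matrices, and define the permuted block acting on the permuted input P_in x with weights P_{W_0} W_0 P_attnᵀ, P_{W_1} W_1 P_{W_0}ᵀ, P_{W_2} W_2 P_{W_1}ᵀ, wrapped attention x ↦ P_attn f(P_inᵀ x), and with the residual identity mappings replaced by the compositions 𝓘_i = P_{W_0} P_inᵀ (in the first residual sum) and 𝓘_out = P_{W_2} P_{W_0}ᵀ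 (in the second residual sum). Then for every x ∈ ℝ^d the permuted block's intermediate output satisfies z_i' = P_{W_0} z_i and its final output satisfies z_out' = P_{W_2} z_out. -/
open Matrix

/-- Entrywise ReLU on vectors: `ReLU(v)_j = max (v_j, 0)`. -/
def relu {d : ℕ} (v : Fin d → ℝ) : Fin d → ℝ := fun j => max (v j) 0

theorem permMatrix_mulVec_apply {d : ℕ} (σ : Equiv.Perm (Fin d)) (v : Fin d → ℝ) (u : Fin d) :
    (permMatrix σ).mulVec v u = v (σ.symm u) := by
  have h : ∀ w, (u = σ w) = (w = σ.symm u) := by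
    intro w
    rw [Equiv.eq_symm_apply]
    exact propext eq_comm
  simp [permMatrix, Matrix.mulVec, dotProduct, h]

theorem permMatrix_transpose_mulVec {d : ℕ} (σ : Equiv.Perm (Fin d)) (v : Fin d → ℝ) :
    (permMatrix σ)ᵀ.mulVec ((permMatrix σ).mulVec v) = v := by
  funext u
  have h : (permMatrix σ)ᵀ.mulVec ((permMatrix σ).mulVec v) u
      = (permMatrix σ).mulVec v (σ u) := by
    simp [permMatrix, Matrix.mulVec, dotProduct]
  rw [h, permMatrix_mulVec_apply, Equiv.symm_apply_apply]

theorem relu_permMatrix {d : ℕ} (σ : Equiv.Perm (Fin d)) (v : Fin d → ℝ) :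
    relu ((permMatrix σ).mulVec v) = (permMatrix σ).mulVec (relu v) := by
  funext u
  simp only [relu, permMatrix_mulVec_apply]

/-- A transformer residual block computes
`z_attn = W_0 f(x)`, `z_i = z_attn + x`, `z_f = W_2 ReLU(W_1 z_i)`, `z_out = z_f + z_i`.
The permuted block acting on the permuted input `P_in x` uses weights
`P_{W_0} W_0 P_attnᵀ`, `P_{W_1} W_1 P_{W_0}ᵀ`, `P_{W_2} W_2 P_{W_1}ᵀ`, wrapped attention
`x ↦ P_attn f(P_inᵀ x)`, and residual identities replaced by `𝓘_i = P_{W_0} P_inᵀ` and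
`𝓘_out = P_{W_2} P_{W_0}ᵀ`. Then `z_i' = P_{W_0} z_i` and `z_out' = P_{W_2} z_out`. -/
theorem residual_block_perm_equivalence {d : ℕ}
    (W₀ W₁ W₂ : Matrix (Fin d) (Fin d) ℝ) (f : (Fin d → ℝ) → (Fin d → ℝ))
    (pin pattn pw0 pw1 pw2 : Equiv.Perm (Fin d)) :
    ∀ x : Fin d → ℝ,
      let zattn := W₀.mulVec (f x)
      let zi := zattn + x
      let zf := W₂.mulVec (relu (W₁.mulVec zi))
      let zout := zf + zi
      let y := (permMatrix pin).mulVec x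
      let zattn' := (permMatrix pw0 * W₀ * (permMatrix pattn)ᵀ).mulVec
        ((permMatrix pattn).mulVec (f ((permMatrix pin)ᵀ.mulVec y)))
      let zi' := zattn' + (permMatrix pw0 * (permMatrix pin)ᵀ).mulVec y
      let zf' := (permMatrix pw2 * W₂ * (permMatrix pw1)ᵀ).mulVec
        (relu ((permMatrix pw1 * W₁ * (permMatrix pw0)ᵀ).mulVec zi'))
      let zout' := zf' + (permMatrix pw2 * (permMatrix pw0)ᵀ).mulVec zi'
      zi' = (permMatrix pw0).mulVec zi ∧ zout' = (permMatrix pw2).mulVec zout := by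
  intro x zattn zi zf zout y zattn' zi' zf' zout'
  have h1 : zi' = (permMatrix pw0).mulVec zi := by
    simp only [zi', zattn', y, zi, zattn, ← Matrix.mulVec_mulVec, permMatrix_transpose_mulVec,
      Matrix.mulVec_add]
  refine ⟨h1, ?_⟩
  simp only [zout', zf', h1, zout, zf, ← Matrix.mulVec_mulVec, permMatrix_transpose_mulVec,
    relu_permMatrix, Matrix.mulVec_add (permMatrix pw2)]
end
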